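/- Let a and b be real numbers with 0 < a < 1 and 0 < b < 1. Then for every ε > 0 there is a constant C = C(a,b,ε) such that for every integer n ≥ 2, | S_{a,b}(n) − [Γ(a+1)Γ(b+1)/Γ(a+b+2)]·[ζ(a+1)ζ(b+1)/ζ(a+b+2)]·σ_{a+b+1}(n) | ≤ C·n^{a+b+1+ε − ab/(a+b−ab)}. -/

import Mathlib

open Finset

/-- `σ_a(n) = ∑_{d ∣ n} d^a` for real `a`. -/
noncomputable def sigmaR (a : ℝ) (n : ℕ) : ℝ := ∑ d ∈ n.divisors, (d : ℝ) ^ a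

/-- `S_{a,b}(n) = ∑_{k=1}^{n-1} σ_a(k) σ_b(n-k)`. -/
noncomputable def SR (a b : ℝ) (n : ℕ) : ℝ :=
  ∑ k ∈ Finset.Ico 1 n, sigmaR a k * sigmaR b (n - k)

/-- The Riemann zeta function at a real argument (it takes real values there). -/
noncomputable def zetaR (x : ℝ) : ℝ := (riemannZeta (x : ℂ)).re

theorem div_bound (ε : ℝ) (hε : 0 < ε) : ∃ C : ℝ, 0 ≤ C ∧ ∀ n : ℕ, n ≠ 0 →
    (n.divisors.card : ℝ) ≤ C * (n : ℝ) ^ ε := by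
  have hl2 : 0 < Real.log 2 := Real.log_pos (by norm_num)
  set K : ℝ := 1 + 1 / (ε * Real.log 2) with hK
  have hK1 : 1 ≤ K := by rw [hK]; have : 0 < 1 / (ε * Real.log 2) := by positivity
                         linarith
  set M : ℕ := ⌈(2:ℝ) ^ (1/ε)⌉₊ with hM
  refine ⟨K ^ M, by positivity, fun n hn => ?_⟩
  have hn' : (n : ℝ) ^ ε = ∏ p ∈ n.primeFactors, ((p : ℝ) ^ ε) ^ (n.factorization p) := by
    conv_lhs => rw [← Nat.prod_factorization_pow_eq_self hn, Finsupp.prod, Nat.support_factorization]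
    push_cast
    rw [← Real.finsetProd_rpow _ _ (fun i _ => by positivity)]
    refine Finset.prod_congr rfl fun p _ => ?_
    rw [← Real.rpow_natCast, ← Real.rpow_natCast, ← Real.rpow_mul (by positivity), ← Real.rpow_mul (by positivity), mul_comm]
  rw [Nat.card_divisors hn, hn']
  push_cast
  have h1 : ∀ p ∈ n.primeFactors, ((n.factorization p : ℝ) + 1) ≤ (if p < M then K else 1) * ((p : ℝ) ^ ε) ^ (n.factorization p) := by
    intro p hp
    have hp2 : (2:ℝ) ≤ p := by exact_mod_cast (Nat.prime_of_mem_primeFactors hp).two_le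
    set k := n.factorization p
    split_ifs with h
    · have h2 : 1 + ε * Real.log 2 ≤ (p:ℝ) ^ ε := by
        calc 1 + ε * Real.log 2 ≤ Real.exp (ε * Real.log 2) := by linarith [Real.add_one_le_exp (ε * Real.log 2)]
          _ = (2:ℝ) ^ ε := by rw [Real.rpow_def_of_pos (by norm_num), mul_comm]
          _ ≤ _ := Real.rpow_le_rpow (by norm_num) hp2 hε.le
      have h3 : 1 + k * (ε * Real.log 2) ≤ ((p:ℝ) ^ ε)^k := by
        refine le_trans (one_add_mul_le_pow (by nlinarith [mul_pos hε hl2]) k) ?_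
        exact pow_le_pow_left₀ (by positivity) h2 k
      have hx : 0 < ε * Real.log 2 := by positivity
      calc (k:ℝ) + 1 ≤ K * (1 + k * (ε * Real.log 2)) := by
            rw [hK]
            have : (1 + 1 / (ε * Real.log 2)) * (1 + k * (ε * Real.log 2)) = 1 + k + k * (ε * Real.log 2) + 1 / (ε * Real.log 2) := by
              field_simp; ring
            rw [this]
            have : 0 ≤ k * (ε * Real.log 2) + 1 / (ε * Real.log 2) := by positivity
            linarith
        _ ≤ _ := by gcongr
    · have h2 : (2:ℝ) ≤ (p:ℝ) ^ ε := by
        have : (2:ℝ) ^ (1/ε) ≤ p := (Nat.le_ceil _).trans (by exact_mod_cast not_lt.mp h)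
        calc (2:ℝ) = ((2:ℝ) ^ (1/ε)) ^ ε := by rw [← Real.rpow_mul (by norm_num)]; field_simp; simp
          _ ≤ _ := Real.rpow_le_rpow (by positivity) this hε.le
      have : ((k+1 : ℕ) : ℝ) ≤ ((2 ^ k : ℕ) : ℝ) := by exact_mod_cast Nat.lt_two_pow_self
      push_cast at this
      rw [one_mul]
      exact this.trans (pow_le_pow_left₀ (by norm_num) h2 k)
  refine (Finset.prod_le_prod (fun i _ => by positivity) h1).trans ?_
  rw [Finset.prod_mul_distrib]
  gcongr
  rw [Finset.prod_ite, Finset.prod_const, Finset.prod_const_one, mul_one]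
  refine pow_le_pow_right₀ hK1 ?_
  calc _ ≤ (Finset.range M).card := Finset.card_le_card (fun x hx => by simp at hx ⊢; exact hx.2)
    _ = M := by simp


theorem ap_step (f G : ℝ → ℝ) (hf : Continuous f) (hfG : ∀ x y, x ≤ y → |f y - f x| ≤ G y - G x)
    (x m : ℝ) (hm : 0 < m) :
    |m * f (x + m) - ∫ t in x..(x+m), f t| ≤ m * (G (x + m) - G x) := by
  have hG : Monotone G := fun u v h => by have := (abs_nonneg _).trans (hfG u v h); linarith
  have h1 : m * f (x+m) - ∫ t in x..(x+m), f t = ∫ t in x..(x+m), (f (x+m) - f t) := by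
    rw [intervalIntegral.integral_sub (by simp) (hf.intervalIntegrable _ _)]
    simp
  rw [h1]
  have := intervalIntegral.norm_integral_le_of_norm_le_const (a := x) (b := x+m) (C := G (x+m) - G x)
    (f := fun t => f (x+m) - f t) (fun t ht => by
      rw [Set.uIoc_of_le (by linarith)] at ht
      rw [Real.norm_eq_abs]
      refine (hfG t (x+m) ht.2).trans ?_
      have := hG ht.1.le
      linarith)
  rw [Real.norm_eq_abs] at this
  refine this.trans (le_of_eq ?_)
  rw [add_sub_cancel_left, abs_of_pos hm, mul_comm]

theorem ap_sum (f G : ℝ → ℝ) (hf : Continuous f) (hfG : ∀ x y, x ≤ y → |f y - f x| ≤ G y - G x)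
    (x m : ℝ) (hm : 0 < m) (N : ℕ) :
    |m * ∑ j ∈ Finset.range N, f (x + (j + 1) * m) - ∫ t in x..(x+N*m), f t| ≤ m * (G (x + N * m) - G x) := by
  induction N with
  | zero => simp
  | succ N ih =>
    have h := ap_step f G hf hfG (x + N * m) m hm
    have e : x + N * m + m = x + ((N:ℝ)+1) * m := by ring
    rw [e] at h
    push_cast
    rw [Finset.sum_range_succ, ← intervalIntegral.integral_add_adjacent_intervals
      (hf.intervalIntegrable x (x + N*m)) (hf.intervalIntegrable (x + N*m) _)]
    have := abs_add_le (m * ∑ j ∈ Finset.range N, f (x + (j + 1) * m) - ∫ t in x..(x+N*m), f t) (m * f (x + ((N:ℝ)+1) * m) - ∫ t in (x + N*m)..(x + ((N:ℝ)+1)*m), f t)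
    refine le_trans (le_of_eq ?_) (this.trans ((add_le_add ih h).trans (le_of_eq ?_)))
    · congr 1; ring
    · ring

theorem beta_int (a b : ℝ) (ha : 0 < a) (hb : 0 < b) (n : ℝ) (hn : 0 < n) :
    ∫ x in (0:ℝ)..n, x ^ a * (n - x) ^ b =
      n ^ (a + b + 1) * (Real.Gamma (a + 1) * Real.Gamma (b + 1) / Real.Gamma (a + b + 2)) := by
  have h := Complex.betaIntegral_scaled (a+1 : ℝ) (b+1 : ℝ) hn
  have h2 : (∫ x in (0:ℝ)..n, ((x ^ a * (n - x) ^ b : ℝ) : ℂ)) = ∫ (x : ℝ) in (0:ℝ)..n, (x:ℂ) ^ (((a+1:ℝ):ℂ) - 1) * ((n:ℂ) - x) ^ (((b+1:ℝ):ℂ) - 1) := by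
    refine intervalIntegral.integral_congr fun x hx => ?_
    rw [Set.uIcc_of_le hn.le] at hx
    rw [Complex.ofReal_mul, Complex.ofReal_cpow hx.1, Complex.ofReal_cpow (by linarith [hx.2])]
    push_cast
    simp
  rw [← h2, intervalIntegral.integral_ofReal] at h
  have h3 := ProbabilityTheory.beta_eq_betaIntegralReal (a+1) (b+1) (by linarith) (by linarith)
  have h4 : (n:ℂ) ^ (((a+1:ℝ):ℂ) + ((b+1:ℝ):ℂ) - 1) = ((n ^ (a+b+1) : ℝ) : ℂ) := by
    rw [Complex.ofReal_cpow hn.le]; congr 1; push_cast; ring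
  rw [h4] at h
  have h5 := congrArg Complex.re h
  rw [Complex.ofReal_re, Complex.re_ofReal_mul, ← h3, ProbabilityTheory.beta] at h5
  rw [h5]
  congr 3; ring

theorem ap_main (a b : ℝ) (ha : 0 < a) (hb : 0 < b) (n : ℕ) (hn : 0 < n) (m r : ℕ) (hr : r < m) :
    |∑ k ∈ (Finset.range n).filter (fun k => k % m = r), (k:ℝ) ^ a * ((n:ℝ) - k) ^ b
      - (n:ℝ) ^ (a + b + 1) * (Real.Gamma (a + 1) * Real.Gamma (b + 1) / Real.Gamma (a + b + 2)) / m|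
    ≤ 2 * (n:ℝ) ^ (a+b) := by
  have hn' : (0:ℝ) < n := by exact_mod_cast hn
  have hm : (0:ℝ) < m := by exact_mod_cast (by omega : 0 < m)
  set c : ℝ → ℝ := fun x => max 0 (min x n) with hc
  have hc0 : ∀ x, 0 ≤ c x := fun x => le_max_left _ _
  have hcn : ∀ x, c x ≤ n := fun x => max_le hn'.le (min_le_right _ _)
  have hcm : Monotone c := fun x y h => max_le_max le_rfl (min_le_min h le_rfl)
  have hcz : ∀ x, x ≤ 0 → c x = 0 := fun x hx => max_eq_left ((min_le_left _ _).trans hx)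
  have hcN : ∀ x, (n:ℝ) ≤ x → c x = n := fun x hx => by simp [hc, min_eq_right hx]
  have hcI : ∀ x : ℝ, 0 ≤ x → x ≤ n → c x = x := fun x h1 h2 => by simp [hc, min_eq_left h2, h1]
  set f : ℝ → ℝ := fun x => (c x) ^ a * ((n:ℝ) - c x) ^ b with hfdef
  set G : ℝ → ℝ := fun x => (n:ℝ) ^ b * (c x) ^ a - (n:ℝ) ^ a * ((n:ℝ) - c x) ^ b with hGdef
  have hccont : Continuous c := by fun_prop
  have hf : Continuous f :=
    (hccont.rpow_const (fun _ => Or.inr ha.le)).mul ((continuous_const.sub hccont).rpow_const (fun _ => Or.inr hb.le))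
  have hf0 : ∀ x, x ≤ 0 → f x = 0 := fun x hx => by simp [hfdef, hcz x hx, Real.zero_rpow ha.ne']
  have hfN : ∀ x, (n:ℝ) ≤ x → f x = 0 := fun x hx => by simp [hfdef, hcN x hx, Real.zero_rpow hb.ne']
  have hfG : ∀ x y, x ≤ y → |f y - f x| ≤ G y - G x := by
    intro x y h
    have u1 : (c x)^a ≤ (c y)^a := Real.rpow_le_rpow (hc0 x) (hcm h) ha.le
    have u0 : 0 ≤ (c x)^a := Real.rpow_nonneg (hc0 x) _
    have un : (c y)^a ≤ (n:ℝ)^a := Real.rpow_le_rpow (hc0 y) (hcn y) ha.le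
    have v1 : ((n:ℝ) - c y)^b ≤ ((n:ℝ) - c x)^b := Real.rpow_le_rpow (by linarith [hcn y]) (by linarith [hcm h]) hb.le
    have v0 : 0 ≤ ((n:ℝ) - c y)^b := Real.rpow_nonneg (by linarith [hcn y]) _
    have vn : ((n:ℝ) - c x)^b ≤ (n:ℝ)^b := Real.rpow_le_rpow (by linarith [hcn x]) (by linarith [hc0 x]) hb.le
    simp only [hfdef, hGdef]
    rw [abs_le]
    constructor <;> nlinarith
  have key := ap_sum f G hf hfG ((r:ℝ) - m) m hm (n+1)
  have hr' : (r:ℝ) - m ≤ 0 := by have : (r:ℝ) < m := by exact_mod_cast hr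
                                 linarith
  have hend : (n:ℝ) ≤ (r:ℝ) - m + ((n+1:ℕ):ℝ) * m := by
    have : (1:ℝ) ≤ m := by exact_mod_cast (by omega : 1 ≤ m)
    have h0 : (0:ℝ) ≤ r := by positivity
    push_cast; nlinarith
  have hI : ∫ t in ((r:ℝ) - m)..((r:ℝ) - m + ((n+1:ℕ):ℝ) * m), f t = ∫ x in (0:ℝ)..n, x ^ a * ((n:ℝ) - x) ^ b := by
    rw [← intervalIntegral.integral_add_adjacent_intervals (hf.intervalIntegrable _ 0) (hf.intervalIntegrable 0 _),
      ← intervalIntegral.integral_add_adjacent_intervals (hf.intervalIntegrable 0 n) (hf.intervalIntegrable n _)]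
    have e1 : ∫ t in ((r:ℝ) - m)..0, f t = 0 := by
      rw [intervalIntegral.integral_congr (g := fun _ => 0)]
      · simp
      · intro x hx; rw [Set.uIcc_of_le hr'] at hx; exact hf0 x hx.2
    have e2 : ∫ t in (n:ℝ)..((r:ℝ) - m + ((n+1:ℕ):ℝ) * m), f t = 0 := by
      rw [intervalIntegral.integral_congr (g := fun _ => 0)]
      · simp
      · intro x hx; rw [Set.uIcc_of_le hend] at hx; exact hfN x hx.1
    rw [e1, e2, zero_add, add_zero]
    refine intervalIntegral.integral_congr fun x hx => ?_
    rw [Set.uIcc_of_le hn'.le] at hx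
    simp only [hfdef, hcI x hx.1 hx.2]
  rw [hI, beta_int a b ha hb n hn'] at key
  have hG : G ((r:ℝ) - m + ((n+1:ℕ):ℝ) * m) - G ((r:ℝ) - m) = 2 * (n:ℝ)^(a+b) := by
    simp only [hGdef, hcz _ hr', hcN _ hend]
    rw [Real.rpow_add hn', sub_self, Real.zero_rpow ha.ne', Real.zero_rpow hb.ne']; simp; ring
  rw [hG] at key
  have hS : ∑ j ∈ Finset.range (n+1), f ((r:ℝ) - m + ((j:ℝ)+1)*m) =
      ∑ k ∈ (Finset.range n).filter (fun k => k % m = r), (k:ℝ) ^ a * ((n:ℝ) - k) ^ b := by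
    rw [← Finset.sum_filter_of_ne (p := fun j => r + j * m < n)]
    · refine Finset.sum_nbij' (fun j => r + j * m) (fun k => k / m) ?_ ?_ ?_ ?_ ?_
      · intro j hj
        simp only [Finset.mem_filter, Finset.mem_range] at hj ⊢
        exact ⟨hj.2, by rw [Nat.add_mul_mod_self_right, Nat.mod_eq_of_lt hr]⟩
      · intro k hk
        simp only [Finset.mem_filter, Finset.mem_range] at hk ⊢
        have h1 := Nat.div_le_self k m
        have h2 := Nat.mod_add_div k m
        rw [mul_comm] at h2
        refine ⟨by omega, ?_⟩
        rw [hk.2] at h2; omega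
      · intro j hj
        rw [Nat.add_mul_div_right _ _ (by omega), Nat.div_eq_of_lt hr, zero_add]
      · intro k hk
        simp only [Finset.mem_filter, Finset.mem_range] at hk ⊢
        have h2 := Nat.mod_add_div k m
        rw [mul_comm] at h2
        rw [hk.2] at h2; omega
      · intro j hj
        simp only [Finset.mem_filter, Finset.mem_range] at hj ⊢
        have e : (r:ℝ) - m + ((j:ℝ)+1)*m = ((r + j * m : ℕ) : ℝ) := by push_cast; ring
        rw [e]
        simp only [hfdef]
        rw [hcI _ (by positivity) (by exact_mod_cast hj.2.le)]
    · intro j _ hne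
      by_contra hlt
      apply hne
      apply hfN
      have : (n:ℝ) ≤ ((r + j*m : ℕ):ℝ) := by exact_mod_cast not_lt.mp hlt
      push_cast at this; linarith
  rw [hS] at key
  have e : ∀ X Y : ℝ, X - Y / m = (m * X - Y) / m := fun X Y => by field_simp
  rw [e, abs_div, abs_of_pos hm, div_le_iff₀ hm]
  linarith

theorem W_bound (a b : ℝ) (ha : 0 < a) (hb : 0 < b) (n : ℕ) (hn : 0 < n) (d e : ℕ) (hd : 0 < d) (he : 0 < e) :
    |∑ k ∈ (Finset.range n).filter (fun k => d ∣ k ∧ e ∣ n - k), (k:ℝ) ^ a * ((n:ℝ) - k) ^ b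
      - (n:ℝ) ^ (a + b + 1) * (Real.Gamma (a + 1) * Real.Gamma (b + 1) / Real.Gamma (a + b + 2)) *
        (if Nat.gcd d e ∣ n then (Nat.gcd d e : ℝ) / (d * e) else 0)|
    ≤ 2 * (n:ℝ) ^ (a+b) := by
  split_ifs with h
  · obtain ⟨r, hr1, hr2⟩ := Nat.chineseRemainder' (n := d) (m := e) (a := 0) (b := n) ((Nat.modEq_zero_iff_dvd.2 h).symm)
    have hl : 0 < Nat.lcm d e := Nat.lcm_pos hd he
    have := ap_main a b ha hb n hn (Nat.lcm d e) (r % Nat.lcm d e) (Nat.mod_lt _ hl)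
    have hset : (Finset.range n).filter (fun k => d ∣ k ∧ e ∣ n - k) = (Finset.range n).filter (fun k => k % Nat.lcm d e = r % Nat.lcm d e) := by
      refine Finset.filter_congr fun k hk => ?_
      rw [Finset.mem_range] at hk
      rw [← Nat.modEq_iff_dvd' hk.le, ← Nat.modEq_zero_iff_dvd]
      constructor
      · rintro ⟨h1, h2⟩
        exact Nat.mod_lcm (h1.trans hr1.symm) (h2.trans hr2.symm)
      · intro h3
        have h3 : k ≡ r [MOD Nat.lcm d e] := h3
        exact ⟨(h3.of_dvd (Nat.dvd_lcm_left _ _)).trans hr1, (h3.of_dvd (Nat.dvd_lcm_right _ _)).trans hr2⟩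
    rw [hset]
    have hl2 : (Nat.gcd d e : ℝ) * (Nat.lcm d e : ℝ) = d * e := by exact_mod_cast Nat.gcd_mul_lcm d e
    have hg : (Nat.gcd d e : ℝ) ≠ 0 := by exact_mod_cast (Nat.gcd_pos_of_pos_left _ hd).ne'
    have e1 : (Nat.gcd d e : ℝ) / (d * e) = 1 / (Nat.lcm d e : ℝ) := by
      rw [← hl2]; field_simp
    rw [e1, mul_one_div]; exact this
  · have hset : (Finset.range n).filter (fun k => d ∣ k ∧ e ∣ n - k) = ∅ := by
      refine Finset.filter_eq_empty_iff.2 fun k hk hh => h ?_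
      rw [Finset.mem_range] at hk
      have h1 := (Nat.gcd_dvd_left d e).trans hh.1
      have h2 := (Nat.gcd_dvd_right d e).trans hh.2
      have := Nat.dvd_add h1 h2
      rwa [Nat.add_sub_cancel' hk.le] at this
    rw [hset]; simp; positivity

abbrev CopPair := {p : ℕ+ × ℕ+ // Nat.Coprime p.1 p.2}

noncomputable def ZP (s : ℝ) : ℝ := ∑' g : ℕ+, ((g : ℕ) : ℝ) ^ (-s)
noncomputable def TP (s t : ℝ) : ℝ := ∑' p : CopPair, (((p.1.1 : ℕ) : ℝ) ^ (-s) * ((p.1.2 : ℕ) : ℝ) ^ (-t))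

theorem summable_pnat (s : ℝ) (hs : 1 < s) : Summable (fun g : ℕ+ => ((g : ℕ) : ℝ) ^ (-s)) := by
  have : Summable (fun n : ℕ => (n:ℝ) ^ (-s)) := Real.summable_nat_rpow.2 (by linarith)
  exact this.comp_injective PNat.coe_injective

theorem summable_pair (s t : ℝ) (hs : 1 < s) (ht : 1 < t) :
    Summable (fun p : ℕ+ × ℕ+ => ((p.1 : ℕ) : ℝ) ^ (-s) * ((p.2 : ℕ) : ℝ) ^ (-t)) :=
  (summable_pnat s hs).mul_of_nonneg (summable_pnat t ht) (fun _ => by positivity) (fun _ => by positivity)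

theorem zetaR_eq (s : ℝ) (hs : 1 < s) : zetaR s = ZP s := by
  unfold zetaR ZP
  rw [zeta_eq_tsum_one_div_nat_add_one_cpow (by simpa using hs),
    tsum_pnat_eq_tsum_succ (f := fun n : ℕ => (n:ℝ)^(-s))]
  have : ∀ n : ℕ, (1:ℂ) / ((n:ℂ) + 1) ^ (s:ℂ) = (((((n+1 : ℕ)):ℝ) ^ (-s) : ℝ) : ℂ) := by
    intro n
    rw [Complex.ofReal_cpow (by positivity)]
    push_cast
    rw [Complex.cpow_neg, one_div]
  simp_rw [this]
  rw [← Complex.ofReal_tsum, Complex.ofReal_re]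

theorem gcd_bij : Function.Bijective
    (fun q : ℕ+ × CopPair => ((q.1 * q.2.1.1, q.1 * q.2.1.2) : ℕ+ × ℕ+)) := by
  constructor
  · rintro ⟨g, ⟨⟨x, y⟩, h⟩⟩ ⟨g', ⟨⟨x', y'⟩, h'⟩⟩ heq
    simp only [Prod.mk.injEq] at heq h h'
    obtain ⟨h1, h2⟩ := heq
    have e1 : (g:ℕ) * x = g' * x' := by exact_mod_cast congrArg PNat.val h1
    have e2 : (g:ℕ) * y = g' * y' := by exact_mod_cast congrArg PNat.val h2
    have e3 : Nat.gcd (g * x) (g * y) = g := by rw [Nat.gcd_mul_left, h.gcd_eq_one, mul_one]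
    have e4 : Nat.gcd (g' * x') (g' * y') = g' := by rw [Nat.gcd_mul_left, h'.gcd_eq_one, mul_one]
    have e5 : (g:ℕ) = g' := by rw [← e3, ← e4, e1, e2]
    have e6 : g = g' := PNat.coe_injective e5
    subst e6
    have := mul_left_cancel h1
    have := mul_left_cancel h2
    subst_vars; rfl
  · rintro ⟨d, e⟩
    have hg : 0 < Nat.gcd d e := Nat.gcd_pos_of_pos_left _ d.pos
    have hd := Nat.div_mul_cancel (Nat.gcd_dvd_left d e)
    have he := Nat.div_mul_cancel (Nat.gcd_dvd_right d e)
    refine ⟨⟨⟨Nat.gcd d e, hg⟩, ⟨⟨⟨d / Nat.gcd d e, ?_⟩, ⟨e / Nat.gcd d e, ?_⟩⟩, ?_⟩⟩, ?_⟩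
    · exact Nat.div_pos (Nat.le_of_dvd d.pos (Nat.gcd_dvd_left _ _)) hg
    · exact Nat.div_pos (Nat.le_of_dvd e.pos (Nat.gcd_dvd_right _ _)) hg
    · exact Nat.coprime_div_gcd_div_gcd hg
    · simp only [Prod.mk.injEq]
      constructor
      · exact PNat.coe_injective (((mul_comm _ _).trans hd))
      · exact PNat.coe_injective (((mul_comm _ _).trans he))

theorem gcd_hasSum (s t : ℝ) (hs : 1 < s) (ht : 1 < t) (h : ℕ → ℝ) (h0 : ∀ g, 0 ≤ h g)
    (hsum : Summable (fun g : ℕ+ => h g * ((g : ℕ) : ℝ) ^ (-(s+t)))) :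
    HasSum (fun p : ℕ+ × ℕ+ => h (Nat.gcd p.1 p.2) * (((p.1 : ℕ) : ℝ) ^ (-s) * ((p.2 : ℕ) : ℝ) ^ (-t)))
      ((∑' g : ℕ+, h g * ((g : ℕ) : ℝ) ^ (-(s+t))) * TP s t) := by
  have hT : Summable (fun p : CopPair => (((p.1.1 : ℕ) : ℝ) ^ (-s) * ((p.1.2 : ℕ) : ℝ) ^ (-t))) :=
    (summable_pair s t hs ht).comp_injective Subtype.val_injective
  have hprod := hsum.mul_of_nonneg hT (fun g => mul_nonneg (h0 _) (by positivity)) (fun _ => by positivity)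
  have key := hsum.hasSum.mul hT.hasSum hprod
  rw [← (Equiv.ofBijective _ gcd_bij).hasSum_iff]
  refine key.congr_fun ?_ |> fun h => h
  rintro ⟨g, ⟨⟨x, y⟩, hxy⟩⟩
  simp only [Function.comp, Equiv.ofBijective_apply, PNat.mul_coe] at hxy ⊢
  rw [Nat.gcd_mul_left, hxy.gcd_eq_one, mul_one]
  push_cast
  rw [Real.mul_rpow (by positivity) (by positivity), Real.mul_rpow (by positivity) (by positivity), neg_add,
    Real.rpow_add (by positivity)]
  ring

theorem ZP_mul (s t : ℝ) (hs : 1 < s) (ht : 1 < t) : ZP s * ZP t = ZP (s+t) * TP s t := by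
  have h := gcd_hasSum s t hs ht (fun _ => 1) (fun _ => zero_le_one) (by simpa using summable_pnat (s+t) (by linarith))
  simp only [one_mul] at h
  have h2 := (summable_pnat s hs).hasSum.mul (summable_pnat t ht).hasSum (summable_pair s t hs ht)
  exact h2.unique h

theorem ZP_pos (s : ℝ) (hs : 1 < s) : 0 < ZP s :=
  (summable_pnat s hs).tsum_pos (fun _ => by positivity) 1 (by simp)

theorem TP_nonneg (s t : ℝ) : 0 ≤ TP s t := tsum_nonneg fun _ => by positivity

theorem div_hasSum (s : ℝ) (n : ℕ) (hn : 0 < n) :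
    HasSum (fun g : ℕ+ => (if (g:ℕ) ∣ n then ((g:ℕ):ℝ) else 0) * ((g : ℕ) : ℝ) ^ (-s))
      ((n:ℝ) ^ (1 - s) * sigmaR (s - 1) n) := by
  have hn' : (0:ℝ) < n := by exact_mod_cast hn
  have e : (n:ℝ) ^ (1 - s) * sigmaR (s - 1) n = ∑ d ∈ n.divisors, (d:ℝ) ^ (1 - s) := by
    unfold sigmaR
    rw [Finset.mul_sum, ← Nat.sum_div_divisors n (fun d => (d:ℝ) ^ (1-s))]
    refine Finset.sum_congr rfl fun d hd => ?_
    have hdn := Nat.dvd_of_mem_divisors hd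
    have hd0 : (0:ℝ) < d := by exact_mod_cast Nat.pos_of_mem_divisors hd
    rw [Nat.cast_div hdn hd0.ne', Real.div_rpow hn'.le hd0.le, show s - 1 = -(1-s) by ring, Real.rpow_neg hd0.le]
    field_simp
  rw [e]
  have h1 : HasSum (fun g : ℕ => if g ∈ n.divisors then (g:ℝ) ^ (1 - s) else 0) (∑ d ∈ n.divisors, (d:ℝ) ^ (1 - s)) := by
    have := hasSum_sum_of_ne_finset_zero (L := SummationFilter.unconditional ℕ) (s := n.divisors) (f := fun g : ℕ => if g ∈ n.divisors then (g:ℝ) ^ (1 - s) else 0)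
      (fun b hb => by simp only [hb, if_false])
    rwa [Finset.sum_congr rfl (g := fun d : ℕ => (d:ℝ) ^ (1 - s)) (fun x hx => by simp only [hx, if_true])] at this
  have h2 := (Function.Injective.hasSum_iff PNat.coe_injective (f := fun g : ℕ => if g ∈ n.divisors then (g:ℝ) ^ (1 - s) else 0) (a := ∑ d ∈ n.divisors, (d:ℝ) ^ (1 - s)) (by
    intro x hx
    have : x = 0 := by
      by_contra h
      exact hx ⟨⟨x, Nat.pos_of_ne_zero h⟩, rfl⟩
    subst this
    simp)).2 h1
  refine h2.congr_fun ?_ |> fun h => h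
  intro g
  have hg : (0:ℝ) < ((g:ℕ):ℝ) := by exact_mod_cast g.pos
  simp only [Function.comp, Nat.mem_divisors, hn.ne', ne_eq, not_false_eq_true, and_true]
  split_ifs
  · rw [sub_eq_add_neg, Real.rpow_add hg, Real.rpow_one]
  · simp

noncomputable def wt (n : ℕ) (s t : ℝ) (p : ℕ+ × ℕ+) : ℝ :=
  (if Nat.gcd p.1 p.2 ∣ n then (Nat.gcd p.1 p.2 : ℝ) else 0) * (((p.1 : ℕ) : ℝ) ^ (-s) * ((p.2 : ℕ) : ℝ) ^ (-t))

theorem wt_nonneg (n : ℕ) (s t : ℝ) (p : ℕ+ × ℕ+) : 0 ≤ wt n s t p := by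
  unfold wt; split_ifs <;> positivity

theorem wt_hasSum (n : ℕ) (hn : 0 < n) (s t : ℝ) (hs : 1 < s) (ht : 1 < t) :
    HasSum (wt n s t) ((n:ℝ) ^ (1 - (s+t)) * sigmaR (s + t - 1) n * TP s t) := by
  have h := gcd_hasSum s t hs ht (fun g => if g ∣ n then (g:ℝ) else 0) (fun g => by split_ifs <;> positivity)
    (div_hasSum (s+t) n hn).summable
  rwa [(div_hasSum (s+t) n hn).tsum_eq] at h

theorem wt_tsum_le (n : ℕ) (hn : 0 < n) (s t : ℝ) (hs : 1 < s) (ht : 1 < t) :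
    (n:ℝ) ^ (1 - (s+t)) * sigmaR (s + t - 1) n * TP s t ≤ ZP (s+t-1) * TP s t := by
  refine mul_le_mul_of_nonneg_right ?_ (TP_nonneg _ _)
  refine hasSum_le ?_ (div_hasSum (s+t) n hn) (summable_pnat (s+t-1) (by linarith)).hasSum
  intro g
  have hg : (0:ℝ) < ((g:ℕ):ℝ) := by exact_mod_cast g.pos
  split_ifs
  · rw [show -(s+t-1) = 1 + -(s+t) by ring, Real.rpow_add hg, Real.rpow_one]
  · rw [zero_mul]; positivity

theorem wt_main (n : ℕ) (hn : 0 < n) (a b : ℝ) (ha : 0 < a) (hb : 0 < b) :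
    HasSum (wt n (a+1) (b+1)) ((n:ℝ) ^ (-(a+b+1)) * sigmaR (a + b + 1) n * (zetaR (a + 1) * zetaR (b + 1) / zetaR (a + b + 2))) := by
  have h := wt_hasSum n hn (a+1) (b+1) (by linarith) (by linarith)
  have e : TP (a+1) (b+1) = zetaR (a + 1) * zetaR (b + 1) / zetaR (a + b + 2) := by
    rw [zetaR_eq _ (by linarith), zetaR_eq _ (by linarith), zetaR_eq _ (by linarith), ZP_mul _ _ (by linarith) (by linarith)]
    rw [show a + 1 + (b+1) = a + b + 2 by ring]
    have := ZP_pos (a+b+2) (by linarith)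
    field_simp
  rw [← e]
  convert h using 4
  · ring
  · ring

noncomputable def Wd (a b : ℝ) (n d e : ℕ) : ℝ :=
  ∑ k ∈ (Finset.range n).filter (fun k => d ∣ k ∧ e ∣ n - k), (k:ℝ) ^ a * ((n:ℝ) - k) ^ b

theorem sigmaR_eq (a : ℝ) (k : ℕ) : sigmaR a k = (k:ℝ) ^ a * ∑ d ∈ k.divisors, (d:ℝ) ^ (-a) := by
  unfold sigmaR
  rw [Finset.mul_sum, ← Nat.sum_div_divisors k (fun d => (d:ℝ) ^ a)]
  refine Finset.sum_congr rfl fun d hd => ?_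
  have hdn := Nat.dvd_of_mem_divisors hd
  have hd0 : (0:ℝ) < d := by exact_mod_cast Nat.pos_of_mem_divisors hd
  rw [Nat.cast_div hdn hd0.ne', Real.div_rpow (by positivity) hd0.le, Real.rpow_neg hd0.le]
  field_simp

theorem lemA (a b : ℝ) (ha : 0 < a) (hb : 0 < b) (n : ℕ) (hn : 0 < n) (P : Finset (ℕ+ × ℕ+)) (D E X B : ℝ)
    (hD : 0 < D) (hE : 0 < E) (hB : 0 ≤ B)
    (hP : ∀ p : ℕ+ × ℕ+, p ∈ P ↔ ((p.1 : ℕ) : ℝ) ≤ D ∧ ((p.2 : ℕ) : ℝ) ≤ E)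
    (hDX : D ^ (-a) = X) (hEX : E ^ (-b) = X)
    (hτ : ∀ k : ℕ, 0 < k → k ≤ n → (k.divisors.card : ℝ) ≤ B) :
    |SR a b n - ∑ p ∈ P, (((p.1 : ℕ) : ℝ) ^ (-a) * ((p.2 : ℕ) : ℝ) ^ (-b)) * Wd a b n p.1 p.2|
      ≤ (n:ℝ) ^ (a + b + 1) * (X * B ^ 2) := by
  have hn' : (0:ℝ) < n := by exact_mod_cast hn
  have hX : 0 < X := by rw [← hDX]; positivity
  set g : ℕ × ℕ → ℝ := fun p => (p.1:ℝ) ^ (-a) * (p.2:ℝ) ^ (-b) with hg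
  set sm : ℕ × ℕ → Prop := fun p => (p.1:ℝ) ≤ D ∧ (p.2:ℝ) ≤ E with hsm
  classical
  have hW : ∀ d e : ℕ, Wd a b n d e = ∑ k ∈ Finset.Ico 1 n, if d ∣ k ∧ e ∣ n - k then (k:ℝ) ^ a * ((n:ℝ) - k) ^ b else 0 := by
    intro d e
    unfold Wd
    rw [Finset.sum_filter, Finset.range_eq_Ico, Finset.sum_eq_sum_Ico_succ_bot hn]
    simp [Real.zero_rpow ha.ne']
  have h1 : ∑ p ∈ P, (((p.1 : ℕ) : ℝ) ^ (-a) * ((p.2 : ℕ) : ℝ) ^ (-b)) * Wd a b n p.1 p.2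
      = ∑ k ∈ Finset.Ico 1 n, ((k:ℝ) ^ a * ((n:ℝ) - k) ^ b) * ∑ p ∈ (k.divisors ×ˢ (n-k).divisors).filter sm, g p := by
    simp_rw [hW, Finset.mul_sum]
    rw [Finset.sum_comm]
    refine Finset.sum_congr rfl fun k hk => ?_
    rw [Finset.mem_Ico] at hk
    rw [← Finset.mul_sum, Finset.mul_sum]
    simp_rw [mul_ite, mul_zero]
    rw [← Finset.sum_filter]
    refine Finset.sum_nbij (fun p : ℕ+ × ℕ+ => ((p.1:ℕ), (p.2:ℕ))) ?_ ?_ ?_ ?_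
    · intro p hp
      simp only [Finset.mem_filter, Finset.mem_product, Nat.mem_divisors] at hp ⊢
      exact ⟨⟨⟨hp.2.1, by omega⟩, ⟨hp.2.2, by omega⟩⟩, (hP p).1 hp.1⟩
    · rintro ⟨x, y⟩ _ ⟨x', y'⟩ _ h
      simp only [Prod.mk.injEq, PNat.coe_inj] at h
      rw [h.1, h.2]
    · rintro ⟨x, y⟩ h
      simp only [Finset.coe_filter, Set.mem_ofPred_eq, Finset.mem_product, Nat.mem_divisors] at h
      have hx : 0 < x := Nat.pos_of_dvd_of_pos h.1.1.1 (by omega)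
      have hy : 0 < y := Nat.pos_of_dvd_of_pos h.1.2.1 (by omega)
      refine ⟨(⟨x, hx⟩, ⟨y, hy⟩), ?_, rfl⟩
      simp only [Finset.coe_filter, Set.mem_ofPred_eq]
      exact ⟨(hP _).2 h.2, h.1.1.1, h.1.2.1⟩
    · intro p _
      simp only [hg]; ring
  have h2 : SR a b n = ∑ k ∈ Finset.Ico 1 n, ((k:ℝ) ^ a * ((n:ℝ) - k) ^ b) * ∑ p ∈ (k.divisors ×ˢ (n-k).divisors), g p := by
    unfold SR
    refine Finset.sum_congr rfl fun k hk => ?_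
    rw [Finset.mem_Ico] at hk
    rw [sigmaR_eq, sigmaR_eq, Nat.cast_sub hk.2.le, Finset.sum_product, mul_mul_mul_comm, Finset.sum_mul_sum]
  rw [h1, h2, ← Finset.sum_sub_distrib]
  have h3 : ∀ k ∈ Finset.Ico 1 n, |((k:ℝ) ^ a * ((n:ℝ) - k) ^ b) * ∑ p ∈ (k.divisors ×ˢ (n-k).divisors), g p -
      ((k:ℝ) ^ a * ((n:ℝ) - k) ^ b) * ∑ p ∈ (k.divisors ×ˢ (n-k).divisors).filter sm, g p| ≤ (n:ℝ) ^ (a+b) * (X * B^2) := by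
    intro k hk
    rw [Finset.mem_Ico] at hk
    have hkn : (k:ℝ) ≤ n := by exact_mod_cast hk.2.le
    rw [← Finset.sum_filter_add_sum_filter_not _ sm g, ← mul_sub, add_sub_cancel_left]
    have k1 : (k:ℝ)^a ≤ (n:ℝ)^a := Real.rpow_le_rpow (by positivity) hkn ha.le
    have k2 : ((n:ℝ)-k)^b ≤ (n:ℝ)^b := Real.rpow_le_rpow (by linarith) (by linarith [(Nat.cast_nonneg k : (0:ℝ) ≤ k)]) hb.le
    have k3 : 0 ≤ ((n:ℝ)-k)^b := Real.rpow_nonneg (by linarith) _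
    have k4 : 0 ≤ ∑ p ∈ (k.divisors ×ˢ (n-k).divisors).filter (fun p => ¬ sm p), g p :=
      Finset.sum_nonneg fun p _ => by simp only [hg]; positivity
    rw [abs_of_nonneg (mul_nonneg (mul_nonneg (by positivity) k3) k4), Real.rpow_add hn']
    refine mul_le_mul (mul_le_mul k1 k2 k3 (by positivity)) ?_ k4 (by positivity)
    have k5 : ∀ p ∈ (k.divisors ×ˢ (n-k).divisors).filter (fun p => ¬ sm p), g p ≤ X := by
      intro p hp
      simp only [Finset.mem_filter, Finset.mem_product] at hp
      have hp1 : (1:ℝ) ≤ p.1 := by exact_mod_cast Nat.pos_of_mem_divisors hp.1.1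
      have hp2 : (1:ℝ) ≤ p.2 := by exact_mod_cast Nat.pos_of_mem_divisors hp.1.2
      have q1 : (p.1:ℝ) ^ (-a) ≤ 1 := Real.rpow_le_one_of_one_le_of_nonpos hp1 (by linarith)
      have q2 : (p.2:ℝ) ^ (-b) ≤ 1 := Real.rpow_le_one_of_one_le_of_nonpos hp2 (by linarith)
      have q3 : 0 ≤ (p.1:ℝ) ^ (-a) := by positivity
      have q4 : 0 ≤ (p.2:ℝ) ^ (-b) := by positivity
      simp only [hg]
      by_cases hd : (p.1:ℝ) ≤ D
      · have he : E < p.2 := by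
          by_contra h; exact hp.2 ⟨hd, not_lt.1 h⟩
        have : (p.2:ℝ) ^ (-b) ≤ X := by rw [← hEX]; exact Real.rpow_le_rpow_of_nonpos hE he.le (by linarith)
        nlinarith
      · have : (p.1:ℝ) ^ (-a) ≤ X := by rw [← hDX]; exact Real.rpow_le_rpow_of_nonpos hD (not_le.1 hd).le (by linarith)
        nlinarith
    refine (Finset.sum_le_card_nsmul _ _ _ k5).trans ?_
    rw [nsmul_eq_mul, mul_comm]
    refine mul_le_mul_of_nonneg_left ?_ hX.le
    have c1 : ((((k.divisors ×ˢ (n-k).divisors).filter (fun p => ¬ sm p)).card : ℕ) : ℝ) ≤ (k.divisors.card : ℝ) * ((n-k).divisors.card : ℝ) := by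
      have := Finset.card_filter_le (k.divisors ×ˢ (n-k).divisors) (fun p => ¬ sm p)
      rw [Finset.card_product] at this
      exact_mod_cast this
    refine c1.trans ?_
    rw [sq]
    exact mul_le_mul (hτ k (by omega) hk.2.le) (hτ (n-k) (by omega) (by omega)) (by positivity) hB
  refine (Finset.abs_sum_le_sum_abs _ _).trans ((Finset.sum_le_card_nsmul _ _ _ h3).trans ?_)
  rw [nsmul_eq_mul, Nat.card_Ico, Real.rpow_add hn' (a+b) 1, Real.rpow_one]
  have : ((n - 1 : ℕ) : ℝ) ≤ n := by exact_mod_cast Nat.sub_le n 1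
  have h5 : 0 ≤ (n:ℝ)^(a+b) * (X * B^2) := by positivity
  calc _ ≤ (n:ℝ) * ((n:ℝ)^(a+b) * (X * B^2)) := mul_le_mul_of_nonneg_right this h5
    _ = _ := by ring

theorem lemB (a b : ℝ) (ha1 : a < 1) (hb1 : b < 1) (P : Finset (ℕ+ × ℕ+)) (D E η : ℝ) (hη : 0 < η)
    (hP : ∀ p : ℕ+ × ℕ+, p ∈ P → ((p.1 : ℕ) : ℝ) ≤ D ∧ ((p.2 : ℕ) : ℝ) ≤ E) (hD : 0 < D) (hE : 0 < E) :
    ∑ p ∈ P, (((p.1 : ℕ) : ℝ) ^ (-a) * ((p.2 : ℕ) : ℝ) ^ (-b)) ≤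
      D ^ (1 - a + η) * E ^ (1 - b + η) * (ZP (1+η) * ZP (1+η)) := by
  have hs := (summable_pnat (1+η) (by linarith)).hasSum.mul (summable_pnat (1+η) (by linarith)).hasSum (summable_pair _ _ (by linarith) (by linarith))
  have h1 := sum_le_hasSum P (fun _ _ => by positivity) hs
  refine le_trans ?_ (mul_le_mul_of_nonneg_left h1 (by positivity))
  rw [Finset.mul_sum]
  refine Finset.sum_le_sum fun p hp => ?_
  obtain ⟨q1, q2⟩ := hP p hp
  have p1 : (0:ℝ) < ((p.1 : ℕ) : ℝ) := by exact_mod_cast p.1.pos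
  have p2 : (0:ℝ) < ((p.2 : ℕ) : ℝ) := by exact_mod_cast p.2.pos
  have e1 : ((p.1 : ℕ) : ℝ) ^ (-a) ≤ D ^ (1 - a + η) * ((p.1 : ℕ) : ℝ) ^ (-(1+η)) := by
    rw [show -a = (1 - a + η) + (-(1+η)) by ring, Real.rpow_add p1]
    gcongr
  have e2 : ((p.2 : ℕ) : ℝ) ^ (-b) ≤ E ^ (1 - b + η) * ((p.2 : ℕ) : ℝ) ^ (-(1+η)) := by
    rw [show -b = (1 - b + η) + (-(1+η)) by ring, Real.rpow_add p2]
    gcongr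
  refine (mul_le_mul e1 e2 (by positivity) (by positivity)).trans (le_of_eq (by ring))

theorem lemC (a b : ℝ) (ha : 0 < a) (hb : 0 < b) (n : ℕ) (hn : 0 < n) (P : Finset (ℕ+ × ℕ+)) (D E X η : ℝ)
    (hD : 0 < D) (hE : 0 < E) (hη : 0 < η) (hη1 : η ≤ 1)
    (hP : ∀ p : ℕ+ × ℕ+, p ∈ P ↔ ((p.1 : ℕ) : ℝ) ≤ D ∧ ((p.2 : ℕ) : ℝ) ≤ E)
    (hDX : D ^ (-a) = X) (hEX : E ^ (-b) = X) (M : ℝ) (hM : HasSum (wt n (a+1) (b+1)) M) :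
    |∑ p ∈ P, wt n (a+1) (b+1) p - M| ≤ X ^ (1 - η) * (ZP (1+a*η + (1+b*η) - 1) * TP (1+a*η) (1+b*η)) := by
  classical
  have hX : 0 < X := by rw [← hDX]; positivity
  have hs : 1 < 1 + a * η := by nlinarith [mul_pos ha hη]
  have ht : 1 < 1 + b * η := by nlinarith [mul_pos hb hη]
  have h1 : HasSum (fun p => if p ∈ P then wt n (a+1) (b+1) p else 0) (∑ p ∈ P, wt n (a+1) (b+1) p) := by
    have := hasSum_sum_of_ne_finset_zero (L := SummationFilter.unconditional _) (s := P) (f := fun p => if p ∈ P then wt n (a+1) (b+1) p else 0)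
      (fun b hb => by simp only [hb, if_false])
    rwa [Finset.sum_congr rfl (g := fun p => wt n (a+1) (b+1) p) (fun x hx => by simp only [hx, if_true])] at this
  have h2 := hM.sub h1
  have h3 := (wt_hasSum n hn _ _ hs ht).mul_left (X ^ (1-η))
  have hle := sum_le_hasSum P (fun p _ => wt_nonneg n _ _ p) hM
  rw [abs_sub_comm, abs_of_nonneg (by linarith)]
  refine (hasSum_le ?_ h2 h3).trans (mul_le_mul_of_nonneg_left (wt_tsum_le n hn _ _ hs ht) (by positivity))
  intro p
  split_ifs with hp
  · rw [sub_self]; exact mul_nonneg (by positivity) (wt_nonneg _ _ _ _)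
  rw [sub_zero]
  unfold wt
  rw [mul_left_comm (X ^ (1 - η))]
  have hgc : (0:ℝ) ≤ (if Nat.gcd p.1 p.2 ∣ n then (Nat.gcd p.1 p.2 : ℝ) else 0) := by split_ifs <;> positivity
  refine mul_le_mul_of_nonneg_left ?_ hgc
  have p1 : (1:ℝ) ≤ ((p.1 : ℕ) : ℝ) := by exact_mod_cast p.1.pos
  have p2 : (1:ℝ) ≤ ((p.2 : ℕ) : ℝ) := by exact_mod_cast p.2.pos
  have hgX : ((p.1 : ℕ) : ℝ) ^ (-a) * ((p.2 : ℕ) : ℝ) ^ (-b) ≤ X := by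
    have q1 : ((p.1:ℕ):ℝ) ^ (-a) ≤ 1 := Real.rpow_le_one_of_one_le_of_nonpos p1 (by linarith)
    have q2 : ((p.2:ℕ):ℝ) ^ (-b) ≤ 1 := Real.rpow_le_one_of_one_le_of_nonpos p2 (by linarith)
    have q3 : 0 ≤ ((p.1:ℕ):ℝ) ^ (-a) := by positivity
    have q4 : 0 ≤ ((p.2:ℕ):ℝ) ^ (-b) := by positivity
    by_cases hd : ((p.1:ℕ):ℝ) ≤ D
    · have he : E < ((p.2:ℕ):ℝ) := by
        by_contra h; exact hp ((hP p).2 ⟨hd, not_lt.1 h⟩)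
      have : ((p.2:ℕ):ℝ) ^ (-b) ≤ X := by rw [← hEX]; exact Real.rpow_le_rpow_of_nonpos hE he.le (by linarith)
      nlinarith
    · have : ((p.1:ℕ):ℝ) ^ (-a) ≤ X := by rw [← hDX]; exact Real.rpow_le_rpow_of_nonpos hD (not_le.1 hd).le (by linarith)
      nlinarith
  have h5 := Real.rpow_le_rpow (by positivity) hgX (by linarith : 0 ≤ 1 - η)
  have x1 : (0:ℝ) < ((p.1 : ℕ) : ℝ) := by linarith
  have x2 : (0:ℝ) < ((p.2 : ℕ) : ℝ) := by linarith
  rw [Real.mul_rpow (by positivity) (by positivity), ← Real.rpow_mul x1.le, ← Real.rpow_mul x2.le] at h5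
  have e1 : ((p.1 : ℕ) : ℝ) ^ (-(a+1)) = ((p.1 : ℕ) : ℝ) ^ (-a * (1-η)) * ((p.1 : ℕ) : ℝ) ^ (-(1+a*η)) := by
    rw [← Real.rpow_add x1]; congr 1; ring
  have e2 : ((p.2 : ℕ) : ℝ) ^ (-(b+1)) = ((p.2 : ℕ) : ℝ) ^ (-b * (1-η)) * ((p.2 : ℕ) : ℝ) ^ (-(1+b*η)) := by
    rw [← Real.rpow_add x2]; congr 1; ring
  rw [e1, e2, mul_mul_mul_comm]
  exact mul_le_mul_of_nonneg_right h5 (by positivity)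

set_option maxHeartbeats 1000000 in
theorem stmt17 (a b : ℝ) (ha : 0 < a) (ha1 : a < 1) (hb : 0 < b) (hb1 : b < 1) :
    ∀ ε > 0, ∃ C : ℝ, ∀ n : ℕ, 2 ≤ n →
      |SR a b n
        - (Real.Gamma (a + 1) * Real.Gamma (b + 1) / Real.Gamma (a + b + 2))
            * (zetaR (a + 1) * zetaR (b + 1) / zetaR (a + b + 2)) * sigmaR (a + b + 1) n|
      ≤ C * (n : ℝ) ^ (a + b + 1 + ε - a * b / (a + b - a * b)) := by
  intro ε hε
  obtain ⟨B, hB0, hB⟩ := div_bound (ε/2) (by linarith)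
  set G : ℝ := Real.Gamma (a + 1) * Real.Gamma (b + 1) / Real.Gamma (a + b + 2) with hGdef
  have hG0 : 0 ≤ G := (div_pos (mul_pos (Real.Gamma_pos_of_pos (by linarith)) (Real.Gamma_pos_of_pos (by linarith))) (Real.Gamma_pos_of_pos (by linarith))).le
  set η : ℝ := min ε 1 with hη
  have hη0 : 0 < η := lt_min hε one_pos
  have hη1 : η ≤ 1 := min_le_right _ _
  have hηε : η ≤ ε := min_le_left _ _
  set δ : ℝ := a * b / (a + b - a * b) with hδ
  have hden : 0 < a + b - a * b := by nlinarith
  have hδ0 : 0 < δ := by positivity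
  have hδa : δ / a ≤ 1 := by
    rw [hδ, div_div, div_le_one (by positivity)]; nlinarith [mul_pos ha (mul_pos ha (sub_pos.2 hb1))]
  have hδb : δ / b ≤ 1 := by
    rw [hδ, div_div, div_le_one (by positivity)]; nlinarith [mul_pos hb (mul_pos hb (sub_pos.2 ha1))]
  have hδ1 : δ ≤ 1 := by rw [div_le_one ha] at hδa; linarith
  have hδs : δ / a + δ / b = 1 + δ := by
    rw [hδ]; field_simp; ring
  set K : ℝ := ZP (1+a*η + (1+b*η) - 1) * TP (1+a*η) (1+b*η) with hK
  have hK0 : 0 ≤ K := mul_nonneg (tsum_nonneg fun _ => by positivity) (TP_nonneg _ _)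
  set Z : ℝ := ZP (1+ε/2) * ZP (1+ε/2) with hZ
  have hZ0 : 0 ≤ Z := mul_self_nonneg _
  refine ⟨B^2 + 2 * Z + G * K, fun n hn => ?_⟩
  have hn0 : 0 < n := by omega
  have hN1 : (1:ℝ) ≤ n := by exact_mod_cast hn0
  have hN : (0:ℝ) < n := by linarith
  set D : ℝ := (n:ℝ) ^ (δ/a) with hDdef
  set E : ℝ := (n:ℝ) ^ (δ/b) with hEdef
  set X : ℝ := (n:ℝ) ^ (-δ) with hXdef
  have hD : 0 < D := by positivity
  have hE : 0 < E := by positivity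
  have hDX : D ^ (-a) = X := by rw [hDdef, ← Real.rpow_mul hN.le]; congr 1; field_simp
  have hEX : E ^ (-b) = X := by rw [hEdef, ← Real.rpow_mul hN.le]; congr 1; field_simp
  have hDn : D ≤ (n:ℝ) := by
    calc D ≤ (n:ℝ) ^ (1:ℝ) := Real.rpow_le_rpow_of_exponent_le hN1 hδa
      _ = (n:ℝ) := Real.rpow_one _
  have hEn : E ≤ (n:ℝ) := by
    calc E ≤ (n:ℝ) ^ (1:ℝ) := Real.rpow_le_rpow_of_exponent_le hN1 hδb
      _ = (n:ℝ) := Real.rpow_one _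
  classical
  obtain ⟨P, hP⟩ : ∃ P : Finset (ℕ+ × ℕ+), ∀ p : ℕ+ × ℕ+, p ∈ P ↔ ((p.1 : ℕ) : ℝ) ≤ D ∧ ((p.2 : ℕ) : ℝ) ≤ E := by
    refine ⟨((Finset.Icc 1 (n.toPNat hn0)) ×ˢ (Finset.Icc 1 (n.toPNat hn0))).filter
      (fun p => ((p.1 : ℕ) : ℝ) ≤ D ∧ ((p.2 : ℕ) : ℝ) ≤ E), ?_⟩
    intro p
    rw [Finset.mem_filter, Finset.mem_product, Finset.mem_Icc, Finset.mem_Icc]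
    refine ⟨fun h => h.2, fun h => ⟨⟨⟨one_le, ?_⟩, ⟨one_le, ?_⟩⟩, h⟩⟩
    · have : ((p.1:ℕ):ℝ) ≤ (n:ℝ) := h.1.trans hDn
      rw [← PNat.coe_le_coe]; exact_mod_cast this
    · have : ((p.2:ℕ):ℝ) ≤ (n:ℝ) := h.2.trans hEn
      rw [← PNat.coe_le_coe]; exact_mod_cast this
  have hA := lemA a b ha hb n hn0 P D E X (B * (n:ℝ)^(ε/2)) hD hE (by positivity) hP hDX hEX (by
    intro k hk hkn
    refine (hB k hk.ne').trans ?_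
    have : (k:ℝ) ≤ (n:ℝ) := by exact_mod_cast hkn
    gcongr)
  have hBd := lemB a b ha1 hb1 P D E (ε/2) (by linarith) (fun p hp => (hP p).1 hp) hD hE
  have hM := wt_main n hn0 a b ha hb
  have hC := lemC a b ha hb n hn0 P D E X η hD hE hη0 hη1 hP hDX hEX _ hM
  set M : ℝ := (n:ℝ) ^ (-(a+b+1)) * sigmaR (a + b + 1) n * (zetaR (a + 1) * zetaR (b + 1) / zetaR (a + b + 2)) with hMdef
  have hmain : G * (zetaR (a + 1) * zetaR (b + 1) / zetaR (a + b + 2)) * sigmaR (a + b + 1) n = G * (n:ℝ)^(a+b+1) * M := by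
    have : (n:ℝ) ^ (a+b+1) * (n:ℝ) ^ (-(a+b+1)) = 1 := by rw [← Real.rpow_add hN]; simp
    rw [hMdef]
    linear_combination (-(G * (zetaR (a + 1) * zetaR (b + 1) / zetaR (a + b + 2)) * sigmaR (a + b + 1) n)) * this
  rw [hmain]
  have hmid : |∑ p ∈ P, (((p.1 : ℕ) : ℝ) ^ (-a) * ((p.2 : ℕ) : ℝ) ^ (-b)) * Wd a b n p.1 p.2
      - G * (n:ℝ)^(a+b+1) * ∑ p ∈ P, wt n (a+1) (b+1) p| ≤ 2 * (n:ℝ)^(a+b) * ∑ p ∈ P, (((p.1 : ℕ) : ℝ) ^ (-a) * ((p.2 : ℕ) : ℝ) ^ (-b)) := by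
    rw [Finset.mul_sum, Finset.mul_sum, ← Finset.sum_sub_distrib]
    refine (Finset.abs_sum_le_sum_abs _ _).trans (Finset.sum_le_sum fun p _ => ?_)
    have hw := W_bound a b ha hb n hn0 p.1 p.2 p.1.pos p.2.pos
    have x1 : (0:ℝ) < ((p.1 : ℕ) : ℝ) := by exact_mod_cast p.1.pos
    have x2 : (0:ℝ) < ((p.2 : ℕ) : ℝ) := by exact_mod_cast p.2.pos
    have e : G * (n:ℝ)^(a+b+1) * wt n (a+1) (b+1) p = (((p.1 : ℕ) : ℝ) ^ (-a) * ((p.2 : ℕ) : ℝ) ^ (-b)) *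
        ((n:ℝ) ^ (a + b + 1) * (Real.Gamma (a + 1) * Real.Gamma (b + 1) / Real.Gamma (a + b + 2)) *
        (if Nat.gcd p.1 p.2 ∣ n then (Nat.gcd p.1 p.2 : ℝ) / (((p.1:ℕ):ℝ) * ((p.2:ℕ):ℝ)) else 0)) := by
      unfold wt
      rw [← hGdef, neg_add, neg_add, Real.rpow_add x1, Real.rpow_add x2, Real.rpow_neg_one, Real.rpow_neg_one]
      split_ifs
      · field_simp
      · simp
    rw [e, ← mul_sub, abs_mul, abs_of_nonneg (by positivity), mul_comm]
    exact mul_le_mul_of_nonneg_right hw (by positivity)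
  set T := (n:ℝ) ^ (a + b + 1 + ε - δ) with hT
  have b1 : (n:ℝ) ^ (a + b + 1) * (X * (B * (n:ℝ)^(ε/2)) ^ 2) = B^2 * T := by
    have : T = (n:ℝ)^(a+b+1) * X * ((n:ℝ)^(ε/2) * (n:ℝ)^(ε/2)) := by
      rw [hT, hXdef, ← Real.rpow_add hN, ← Real.rpow_add hN, ← Real.rpow_add hN]; congr 1; ring
    rw [this]; ring
  have b2 : 2 * (n:ℝ)^(a+b) * (D ^ (1 - a + ε/2) * E ^ (1 - b + ε/2) * Z) ≤ 2 * Z * T := by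
    have : (n:ℝ)^(a+b) * (D ^ (1 - a + ε/2) * E ^ (1 - b + ε/2)) ≤ T := by
      rw [hT, hDdef, hEdef, ← Real.rpow_mul hN.le, ← Real.rpow_mul hN.le, ← Real.rpow_add hN, ← Real.rpow_add hN]
      refine Real.rpow_le_rpow_of_exponent_le hN1 ?_
      have e1 : δ / a * (1 - a + ε/2) = δ/a - δ + δ/a*(ε/2) := by field_simp
      have e2 : δ / b * (1 - b + ε/2) = δ/b - δ + δ/b*(ε/2) := by field_simp
      rw [e1, e2]
      have f1 : δ/a*(ε/2) ≤ ε/2 := mul_le_of_le_one_left (by linarith) hδa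
      have f2 : δ/b*(ε/2) ≤ ε/2 := mul_le_of_le_one_left (by linarith) hδb
      linarith
    have h2 := mul_le_mul_of_nonneg_left this (by positivity : 0 ≤ 2 * Z)
    refine le_trans (le_of_eq ?_) h2
    ring
  have b3 : (n:ℝ)^(a+b+1) * X ^ (1-η) ≤ T := by
    rw [hT, hXdef, ← Real.rpow_mul hN.le, ← Real.rpow_add hN]
    refine Real.rpow_le_rpow_of_exponent_le hN1 ?_
    have f1 : δ * η ≤ η := mul_le_of_le_one_left hη0.le hδ1
    have f2 : -δ * (1 - η) = -δ + δ * η := by ring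
    linarith
  have hC' : |G * (n:ℝ)^(a+b+1) * ∑ p ∈ P, wt n (a+1) (b+1) p - G * (n:ℝ)^(a+b+1) * M| ≤ G * K * T := by
    rw [← mul_sub, abs_mul, abs_of_nonneg (by positivity)]
    calc _ ≤ G * (n:ℝ)^(a+b+1) * (X^(1-η) * K) := mul_le_mul_of_nonneg_left hC (by positivity)
      _ = G * K * ((n:ℝ)^(a+b+1) * X^(1-η)) := by ring
      _ ≤ _ := mul_le_mul_of_nonneg_left b3 (by positivity)
  have hmid' := hmid.trans ((mul_le_mul_of_nonneg_left hBd (by positivity)).trans b2)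
  rw [b1] at hA
  have t1 := abs_add_le (SR a b n - ∑ p ∈ P, (((p.1 : ℕ) : ℝ) ^ (-a) * ((p.2 : ℕ) : ℝ) ^ (-b)) * Wd a b n p.1 p.2)
    (∑ p ∈ P, (((p.1 : ℕ) : ℝ) ^ (-a) * ((p.2 : ℕ) : ℝ) ^ (-b)) * Wd a b n p.1 p.2
      - G * (n:ℝ)^(a+b+1) * ∑ p ∈ P, wt n (a+1) (b+1) p)
  have t2 := abs_sub_le (SR a b n) (G * (n:ℝ)^(a+b+1) * ∑ p ∈ P, wt n (a+1) (b+1) p) (G * (n:ℝ)^(a+b+1) * M)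
  rw [sub_add_sub_cancel] at t1
  calc _ ≤ B^2 * T + 2 * Z * T + G * K * T := by linarith
    _ = _ := by ring
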